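/- For every integer n ≥ 1, there is no circle fibration of the even-dimensional sphere S^{2n}: there do not exist a topological space X and a continuous map p : S^{2n} → X which is a fiber bundle with fiber the circle S¹. -/

import Mathlib

section PartA
open MeasureTheory Set

theorem polyContra (n : ℕ) (P : Polynomial ℝ) (c : ℝ) (hc : c ≠ 0)
    (h : P ^ 2 = Polynomial.C (c ^ 2) * (1 + Polynomial.X ^ 2) ^ (2 * n + 1)) : False := by
  have hdeg : (1 + Polynomial.X ^ 2 : Polynomial ℝ).natDegree = 2 := by
    compute_degree!
  have hirr : Irreducible (1 + Polynomial.X ^ 2 : Polynomial ℝ) := by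
    rw [Polynomial.irreducible_iff_roots_eq_zero_of_degree_le_three (by omega) (by omega)]
    rw [Multiset.eq_zero_iff_forall_notMem]
    intro a ha
    have := (Polynomial.mem_roots'.1 ha).2
    simp [Polynomial.IsRoot] at this
    nlinarith [sq_nonneg a]
  have hp : Prime (1 + Polynomial.X ^ 2 : Polynomial ℝ) := hirr.prime
  have hP : P ≠ 0 := by
    rintro rfl
    have : Polynomial.C (c ^ 2) * (1 + Polynomial.X ^ 2 : Polynomial ℝ) ^ (2 * n + 1) ≠ 0 := by
      apply mul_ne_zero
      · simpa using hc
      · exact pow_ne_zero _ hp.ne_zero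
    apply this
    rw [← h]; simp
  have hfin : FiniteMultiplicity (1 + Polynomial.X ^ 2 : Polynomial ℝ) P :=
    FiniteMultiplicity.of_prime_left hp hP
  have e1 := emultiplicity_pow hp (a := P) (k := 2)
  rw [h, emultiplicity_mul hp, emultiplicity_pow_self hp.ne_zero hp.not_isUnit,
    emultiplicity_eq_zero.2, hfin.emultiplicity_eq_multiplicity] at e1
  · norm_cast at e1
    omega
  · intro hd
    have : IsUnit (Polynomial.C (c ^ 2)) := by
      rw [Polynomial.isUnit_C]; exact (pow_ne_zero 2 hc).isUnit
    exact hp.not_isUnit (isUnit_of_dvd_unit hd this)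

theorem detPoly {E : Type*} [NormedAddCommGroup E] [NormedSpace ℝ E] [FiniteDimensional ℝ E]
    (A : E →L[ℝ] E) : ∃ q : Polynomial ℝ, q.natDegree ≤ Module.finrank ℝ E ∧
      ∀ t : ℝ, q.eval t = (ContinuousLinearMap.id ℝ E + t • A).det := by
  let b := Module.finBasis ℝ E
  let M := LinearMap.toMatrix b b (A : E →ₗ[ℝ] E)
  refine ⟨((Polynomial.X : Polynomial ℝ) • M.map Polynomial.C + (1 : Matrix (Fin (Module.finrank ℝ E)) (Fin (Module.finrank ℝ E)) ℝ).map Polynomial.C).det, ?_, ?_⟩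
  · simpa using Polynomial.natDegree_det_X_add_C_le M 1
  · intro t
    rw [← Polynomial.coe_evalRingHom, RingHom.map_det, ContinuousLinearMap.det,
      ← LinearMap.det_toMatrix b]
    congr 1
    ext i j
    simp [M, LinearMap.toMatrix_apply, Matrix.one_apply, Finsupp.single_apply]
    split_ifs <;> simp_all <;> ring

theorem normalize_lip {E : Type*} [NormedAddCommGroup E] [NormedSpace ℝ E] (a b : E) (ha : a ≠ 0)
    (hb : b ≠ 0) : ‖b‖ * ‖‖a‖⁻¹ • a - ‖b‖⁻¹ • b‖ ≤ 2 * ‖a - b‖ := by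
  have ha' : ‖a‖ ≠ 0 := by simpa using ha
  have hb' : ‖b‖ ≠ 0 := by simpa using hb
  have h1 : ‖b‖ * ‖‖a‖⁻¹ • a - ‖b‖⁻¹ • b‖ = ‖((‖b‖ - ‖a‖) * ‖a‖⁻¹) • a + (a - b)‖ := by
    rw [← norm_norm b, ← norm_smul, norm_norm]
    congr 1
    rw [smul_sub, smul_smul, smul_smul, mul_inv_cancel₀ hb', sub_mul, mul_inv_cancel₀ ha', sub_smul]
    simp
  rw [h1]
  refine (norm_add_le _ _).trans ?_
  have h2 : ‖((‖b‖ - ‖a‖) * ‖a‖⁻¹) • a‖ = |‖b‖ - ‖a‖| := by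
    rw [norm_smul, norm_mul, norm_inv, norm_norm, mul_assoc, inv_mul_cancel₀ ha', mul_one,
      Real.norm_eq_abs]
  rw [h2]
  have := abs_norm_sub_norm_le b a
  rw [norm_sub_rev] at this
  linarith

/-- Milnor / Rogers volume argument. -/
theorem volume_argument {E : Type*} [NormedAddCommGroup E] [InnerProductSpace ℝ E]
    [FiniteDimensional ℝ E] [MeasurableSpace E] [BorelSpace E] (n : ℕ)
    (hd : Module.finrank ℝ E = 2 * n + 1) (V : E → E) (K : NNReal) (hK : LipschitzWith K V)
    (hdiff : ∀ x, x ≠ 0 → DifferentiableAt ℝ V x) (hnorm : ∀ x, ‖V x‖ = ‖x‖)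
    (horth : ∀ x, inner ℝ (V x) x = 0) : False := by
  have : Nontrivial E := Module.nontrivial_of_finrank_pos (R := ℝ) (by omega)
  let μ : Measure E := Measure.addHaar
  let f : ℝ → E → E := fun t x => x + t • V x
  let s : Set E := Metric.ball 0 1 \ {0}
  have hs : MeasurableSet s := Metric.isOpen_ball.measurableSet.diff (measurableSet_singleton 0)
  obtain ⟨t0, ht0, hKt⟩ : ∃ t0 : ℝ, 0 < t0 ∧ ∀ t, 0 ≤ t → t < t0 → t * K < 1 := by
    refine ⟨1 / (K + 1), by positivity, fun t h0 h1 => ?_⟩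
    rw [lt_div_iff₀ (by positivity)] at h1
    nlinarith
  have hfn : ∀ t x, ‖f t x‖ = Real.sqrt (1 + t ^ 2) * ‖x‖ := by
    intro t x
    have h1 : ‖f t x‖ ^ 2 = (1 + t ^ 2) * ‖x‖ ^ 2 := by
      simp only [f]
      rw [norm_add_sq_real, inner_smul_right, real_inner_comm, horth, norm_smul, hnorm, mul_pow,
        Real.norm_eq_abs, sq_abs]
      ring
    have h2 : ‖f t x‖ ^ 2 = (Real.sqrt (1 + t ^ 2) * ‖x‖) ^ 2 := by
      rw [h1, mul_pow, Real.sq_sqrt (by positivity)]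
    exact (pow_left_inj₀ (norm_nonneg _) (by positivity) two_ne_zero).1 h2
  have happ : ∀ t, 0 ≤ t → t < t0 → ApproximatesLinearOn (f t)
      ((ContinuousLinearEquiv.refl ℝ E : E ≃L[ℝ] E) : E →L[ℝ] E) univ (t.toNNReal * K) := by
    intro t h0 h1
    rw [ApproximatesLinearOn.approximatesLinearOn_iff_lipschitzOnWith]
    rw [lipschitzOnWith_univ]
    have : (f t - ⇑((ContinuousLinearEquiv.refl ℝ E : E ≃L[ℝ] E) : E →L[ℝ] E)) =
        fun x => t • V x := by
      ext x; simp [f]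
    rw [this]
    refine LipschitzWith.of_dist_le_mul fun x y => ?_
    rw [dist_eq_norm, ← smul_sub, norm_smul, ← dist_eq_norm, Real.norm_of_nonneg h0]
    have := hK.dist_le_mul x y
    push_cast
    rw [Real.coe_toNNReal _ h0, mul_assoc]
    gcongr
  have hlt : ∀ t, 0 ≤ t → t < t0 →
      (t.toNNReal * K) < ‖((ContinuousLinearEquiv.refl ℝ E).symm : E →L[ℝ] E)‖₊⁻¹ := by
    intro t h0 h1
    have e : ‖((ContinuousLinearEquiv.refl ℝ E).symm : E →L[ℝ] E)‖₊ = 1 := by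
      have : ((ContinuousLinearEquiv.refl ℝ E).symm : E →L[ℝ] E) = ContinuousLinearMap.id ℝ E := rfl
      rw [this]
      apply NNReal.eq
      simp
    rw [e, inv_one, ← NNReal.coe_lt_coe]
    push_cast
    rw [Real.coe_toNNReal _ h0]
    exact hKt t h0 h1
  have hinj : ∀ t, 0 ≤ t → t < t0 → Function.Injective (f t) := fun t h0 h1 => by
    have := (happ t h0 h1).injOn (Or.inr (hlt t h0 h1))
    exact injOn_univ.1 this
  have hsurj : ∀ t, 0 ≤ t → t < t0 → Function.Surjective (f t) := fun t h0 h1 =>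
    (happ t h0 h1).surjective (Or.inr (hlt t h0 h1))
  have himg : ∀ t, 0 ≤ t → t < t0 → f t '' s = Metric.ball 0 (Real.sqrt (1 + t ^ 2)) \ {0} := by
    intro t h0 h1
    have hr : 0 < Real.sqrt (1 + t ^ 2) := Real.sqrt_pos.2 (by positivity)
    ext y
    constructor
    · rintro ⟨x, ⟨hx, hx0⟩, rfl⟩
      simp only [mem_ball_zero_iff, mem_singleton_iff] at hx hx0
      have hxp : 0 < ‖x‖ := norm_pos_iff.2 hx0
      refine ⟨?_, ?_⟩
      · rw [mem_ball_zero_iff, hfn]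
        nlinarith
      · rw [mem_singleton_iff, ← ne_eq, ← norm_pos_iff, hfn]
        positivity
    · rintro ⟨hy, hy0⟩
      obtain ⟨x, rfl⟩ := hsurj t h0 h1 y
      simp only [mem_ball_zero_iff, mem_singleton_iff, ← norm_pos_iff, hfn] at hy hy0
      refine ⟨x, ⟨?_, ?_⟩, rfl⟩
      · rw [mem_ball_zero_iff]
        nlinarith
      · rw [mem_singleton_iff, ← ne_eq, ← norm_pos_iff]
        exact pos_of_mul_pos_right hy0 hr.le
  let D : ℝ → E → E →L[ℝ] E := fun t x => ContinuousLinearMap.id ℝ E + t • fderiv ℝ V x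
  have hD : ∀ t, ∀ x ∈ s, HasFDerivWithinAt (f t) (D t x) s x := by
    intro t x hx
    have := ((hasFDerivAt_id (𝕜 := ℝ) x).add ((hdiff x hx.2).hasFDerivAt.const_smul t))
    exact this.hasFDerivWithinAt
  have hcont : ∀ x, Continuous (fun t => (D t x).det) := by
    intro x
    obtain ⟨q, -, hq⟩ := detPoly (fderiv ℝ V x)
    simp only [D, ← hq]
    fun_prop
  have hne : ∀ t, 0 ≤ t → t < t0 → ∀ x, (D t x).det ≠ 0 := by
    intro t h0 h1 x hdet
    have hb : ‖fderiv ℝ V x‖ ≤ K := norm_fderiv_le_of_lipschitz ℝ hK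
    obtain ⟨h, hh, hh0⟩ := (LinearMap.hasEigenvalue_zero_tfae (D t x : E →ₗ[ℝ] E)).out 3 5 |>.1 (by simpa using hdet)
    have e : h = - (t • fderiv ℝ V x h) := by
      have : h + t • fderiv ℝ V x h = 0 := by simpa [D] using hh0
      exact eq_neg_of_add_eq_zero_left this
    have hhp : 0 < ‖h‖ := norm_pos_iff.2 hh
    have e2 : ‖h‖ ≤ t * (K * ‖h‖) := by
      conv_lhs => rw [e, norm_neg, norm_smul, Real.norm_of_nonneg h0]
      gcongr
      exact (fderiv ℝ V x).le_of_opNorm_le hb h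
    have := hKt t h0 h1
    nlinarith
  have hpos : ∀ t, 0 ≤ t → t < t0 → ∀ x, 0 < (D t x).det := by
    intro t h0 h1 x
    by_contra hcon
    push Not at hcon
    have h00 : (D 0 x).det = 1 := by simp [D, ContinuousLinearMap.det]
    have hiv := intermediate_value_Icc' h0 (f := fun t => (D t x).det) (hcont x).continuousOn
    obtain ⟨τ, hτ, hτ0⟩ := hiv (show (0 : ℝ) ∈ _ from ⟨hcon, by simp only [h00]; norm_num⟩)
    exact hne τ hτ.1 (hτ.2.trans_lt h1) x hτ0
  let c : ℝ := μ.real (Metric.ball 0 1)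
  have hc : 0 < c := by
    apply ENNReal.toReal_pos
    · exact (Metric.measure_ball_pos μ 0 one_pos).ne'
    · exact Metric.isBounded_ball.measure_lt_top.ne
  have hintg : ∀ t, 0 ≤ t → t < t0 → IntegrableOn (fun x => (D t x).det) s μ ∧
      ∫ x in s, (D t x).det ∂μ = Real.sqrt (1 + t ^ 2) ^ (2 * n + 1) * c := by
    intro t h0 h1
    have i1 := integrableOn_image_iff_integrableOn_abs_det_fderiv_smul μ hs (hD t)
      (hinj t h0 h1).injOn (fun _ => (1 : ℝ))
    have i2 := integral_image_eq_integral_abs_det_fderiv_smul μ hs (hD t)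
      (hinj t h0 h1).injOn (fun _ => (1 : ℝ))
    simp only [abs_of_pos (hpos t h0 h1 _), smul_eq_mul, mul_one] at i1 i2
    rw [himg t h0 h1] at i1 i2
    constructor
    · apply i1.1
      apply IntegrableOn.mono_set _ sdiff_subset
      refine integrableOn_const ?_
      exact Metric.isBounded_ball.measure_lt_top.ne
    · rw [← i2]
      rw [setIntegral_const, smul_eq_mul, mul_one, Measure.real, measure_sdiff_null (measure_singleton _),
        Measure.addHaar_ball _ _ (Real.sqrt_nonneg _), ENNReal.toReal_mul, ENNReal.toReal_ofReal (by positivity), hd]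
      rfl
  -- interpolation
  let d := 2 * n + 1
  let node : ℕ → ℝ := fun i => t0 * ((i : ℝ) / (d + 1))
  have hnode_inj : Set.InjOn node (Finset.range (d + 1)) := by
    intro i _ j _ h
    have h' : t0 * ((i : ℝ) / (d + 1)) = t0 * ((j : ℝ) / (d + 1)) := h
    have hd1 : ((d : ℝ) + 1) ≠ 0 := by positivity
    field_simp at h'
    exact_mod_cast h'
  have hnode : ∀ i ∈ Finset.range (d + 1), 0 ≤ node i ∧ node i < t0 := by
    intro i hi
    rw [Finset.mem_range] at hi
    refine ⟨by positivity, ?_⟩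
    have : (i : ℝ) / (d + 1) < 1 := by
      rw [div_lt_one (by positivity)]
      exact_mod_cast hi
    simp only [node]
    nlinarith
  let r : ℕ → ℝ := fun i => Real.sqrt (1 + node i ^ 2) ^ (2 * n + 1) * c
  let P : Polynomial ℝ := Lagrange.interpolate (Finset.range (d + 1)) node r
  have hP : ∀ t, 0 ≤ t → t < t0 → P.eval t = Real.sqrt (1 + t ^ 2) ^ (2 * n + 1) * c := by
    intro t h0 h1
    rw [← (hintg t h0 h1).2]
    have hx : ∀ x, (D t x).det = ∑ i ∈ Finset.range (d + 1), (D (node i) x).det *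
        (Lagrange.basis (Finset.range (d + 1)) node i).eval t := by
      intro x
      obtain ⟨q, hq1, hq⟩ := detPoly (fderiv ℝ V x)
      have hq2 : q.degree < ((Finset.range (d + 1)).card : WithBot ℕ) := by
        rw [Finset.card_range]
        refine Polynomial.degree_le_natDegree.trans_lt ?_
        exact_mod_cast (by omega : q.natDegree < d + 1)
      have := Lagrange.eq_interpolate hnode_inj hq2
      simp only [D, ← hq]
      conv_lhs => rw [this, Lagrange.interpolate_apply, Polynomial.eval_finsetSum]
      simp
    simp_rw [hx]
    rw [integral_finsetSum]
    · simp only [P, Lagrange.interpolate_apply, Polynomial.eval_finsetSum, Polynomial.eval_mul,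
        Polynomial.eval_C]
      refine Finset.sum_congr rfl fun i hi => ?_
      rw [integral_mul_const, (hintg (node i) (hnode i hi).1 (hnode i hi).2).2]
    · intro i hi
      exact (hintg (node i) (hnode i hi).1 (hnode i hi).2).1.mul_const _
  refine polyContra n P c hc.ne' ?_
  refine Polynomial.eq_of_infinite_eval_eq _ _ ((Set.Ioo_infinite ht0).mono ?_)
  intro t ht
  simp only [mem_ofPred_eq, Polynomial.eval_pow, hP t ht.1.le ht.2, Polynomial.eval_mul,
    Polynomial.eval_C, Polynomial.eval_add, Polynomial.eval_one, Polynomial.eval_X]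
  rw [mul_pow, ← pow_mul, mul_comm (2 * n + 1) 2, pow_mul, Real.sq_sqrt (by positivity)]
  ring

theorem hairy_ball {E : Type*} [NormedAddCommGroup E] [InnerProductSpace ℝ E]
    [FiniteDimensional ℝ E] (n : ℕ)
    (hd : Module.finrank ℝ E = 2 * n + 1) (v : Metric.sphere (0 : E) 1 → E) (hv : Continuous v)
    (hv0 : ∀ x, v x ≠ 0) (horth : ∀ x, inner ℝ (v x) (x : E) = 0) : False := by
  borelize E
  have : Nontrivial E := Module.nontrivial_of_finrank_pos (R := ℝ) (by omega)
  have : Nonempty (Metric.sphere (0 : E) 1) := (NormedSpace.sphere_nonempty.2 zero_le_one).to_subtype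
  obtain ⟨g, hg⟩ := ContinuousMap.exists_restrict_eq (Metric.isClosed_sphere (x := (0 : E)) (ε := 1)) ⟨v, hv⟩
  have hg' : ∀ x : Metric.sphere (0 : E) 1, g x = v x := fun x => congrArg (fun h => h x) hg
  obtain ⟨x0, -, hx0⟩ := isCompact_univ.exists_isMinOn univ_nonempty hv.norm.continuousOn
  have hc : 0 < ‖v x0‖ := norm_pos_iff.2 (hv0 x0)
  obtain ⟨q, hq, hqg, -⟩ := g.continuous.exists_contDiff_approx 1 (ε := fun _ => ‖v x0‖)
    continuous_const (fun _ => hc)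
  let w : E → E := fun x => q x - (inner ℝ (q x) x : ℝ) • x
  have hw : ContDiff ℝ 1 w := by
    have hq' : ContDiff ℝ 1 q := by exact_mod_cast hq
    exact hq'.sub ((hq'.inner ℝ contDiff_id).smul contDiff_id)
  have hworth : ∀ x, ‖x‖ = 1 → inner ℝ (w x) x = 0 := by
    intro x hx
    simp [w, inner_sub_left, inner_smul_left, hx]
  have hw0 : ∀ x, ‖x‖ = 1 → w x ≠ 0 := by
    intro x hx h0
    let x' : Metric.sphere (0 : E) 1 := ⟨x, by simpa using hx⟩
    have h1 : q x = (inner ℝ (q x) x : ℝ) • x := sub_eq_zero.1 h0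
    have h2 : ‖q x - v x'‖ < ‖v x'‖ := by
      have := hqg x
      rw [← hg' x', ← dist_eq_norm]
      refine this.trans_le ?_
      rw [hg']
      exact hx0 (mem_univ x')
    have h3 : inner ℝ (q x) (v x') = 0 := by
      have h5 : inner ℝ x (v x') = 0 := by
        rw [real_inner_comm]; exact horth x'
      rw [h1, inner_smul_left, h5, mul_zero]
    have h4 : ‖q x - v x'‖ ^ 2 = ‖q x‖ ^ 2 + ‖v x'‖ ^ 2 := by
      rw [norm_sub_sq_real, h3]; ring
    nlinarith [norm_nonneg (q x - v x'), norm_nonneg (v x'), sq_nonneg ‖q x‖]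
  obtain ⟨L, hL⟩ := hw.contDiffOn.exists_lipschitzOnWith one_ne_zero
    (convex_closedBall (0 : E) 1) (isCompact_closedBall 0 1)
  obtain ⟨y0, hy0, hy0m⟩ := (isCompact_sphere (0 : E) 1).exists_isMinOn
    (NormedSpace.sphere_nonempty.2 zero_le_one) hw.continuous.norm.continuousOn
  have hm : 0 < ‖w y0‖ := norm_pos_iff.2 (hw0 y0 (by simpa using hy0))
  have hmle : ∀ x, ‖x‖ = 1 → ‖w y0‖ ≤ ‖w x‖ := fun x hx => hy0m (by simpa using hx)
  let u : E → E := fun y => ‖w y‖⁻¹ • w y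
  let M : ℝ := 2 * L / ‖w y0‖
  have hM : 0 ≤ M := by positivity
  have hu : ∀ a b, ‖a‖ = 1 → ‖b‖ = 1 → ‖u a - u b‖ ≤ M * ‖a - b‖ := by
    intro a b ha hb
    have h1 := normalize_lip (w a) (w b) (hw0 a ha) (hw0 b hb)
    have h2 := hL.dist_le_mul a (by simp [ha]) b (by simp [hb])
    rw [dist_eq_norm, dist_eq_norm] at h2
    have h3 : ‖w y0‖ * ‖u a - u b‖ ≤ 2 * (L * ‖a - b‖) := by
      refine le_trans ?_ (h1.trans ?_)
      · gcongr
        exact hmle b hb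
      · gcongr
    simp only [M]
    rw [div_mul_eq_mul_div, le_div_iff₀ hm]
    linarith
  have hun : ∀ a, ‖a‖ = 1 → ‖u a‖ = 1 := by
    intro a ha
    simp only [u]
    rw [norm_smul, norm_inv, norm_norm, inv_mul_cancel₀ (norm_pos_iff.2 (hw0 a ha)).ne']
  have hnn : ∀ x : E, x ≠ 0 → ‖‖x‖⁻¹ • x‖ = 1 := by
    intro x hx
    rw [norm_smul, norm_inv, norm_norm, inv_mul_cancel₀ (norm_pos_iff.2 hx).ne']
  let V : E → E := fun x => ‖x‖ • u (‖x‖⁻¹ • x)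
  have hVn : ∀ x, ‖V x‖ = ‖x‖ := by
    intro x
    by_cases hx : x = 0
    · simp [V, hx]
    · simp only [V]
      rw [norm_smul, hun _ (hnn x hx), norm_norm, mul_one]
  refine volume_argument n hd V (Real.toNNReal (1 + 2 * M)) ?_ ?_ hVn ?_
  · refine LipschitzWith.of_dist_le_mul fun x y => ?_
    rw [Real.coe_toNNReal _ (by positivity), dist_eq_norm, dist_eq_norm]
    by_cases hx : x = 0
    · subst hx
      have : V 0 = 0 := by simp [V]
      rw [this, zero_sub, zero_sub, norm_neg, norm_neg, hVn]
      nlinarith [norm_nonneg y]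
    by_cases hy : y = 0
    · subst hy
      have : V 0 = 0 := by simp [V]
      rw [this, sub_zero, sub_zero, hVn]
      nlinarith [norm_nonneg x]
    have e : V x - V y = (‖x‖ - ‖y‖) • u (‖x‖⁻¹ • x) +
        ‖y‖ • (u (‖x‖⁻¹ • x) - u (‖y‖⁻¹ • y)) := by
      simp only [V, sub_smul, smul_sub]; abel
    rw [e]
    refine (norm_add_le _ _).trans ?_
    rw [norm_smul _ (u (‖x‖⁻¹ • x)), norm_smul ‖y‖, hun _ (hnn x hx), norm_norm, mul_one,
      Real.norm_eq_abs]
    have h1 := abs_norm_sub_norm_le x y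
    have h2 := hu _ _ (hnn x hx) (hnn y hy)
    have h3 := normalize_lip x y hx hy
    have h4 : ‖y‖ * ‖u (‖x‖⁻¹ • x) - u (‖y‖⁻¹ • y)‖ ≤ M * (2 * ‖x - y‖) := by
      calc _ ≤ ‖y‖ * (M * ‖‖x‖⁻¹ • x - ‖y‖⁻¹ • y‖) := by gcongr
        _ = M * (‖y‖ * ‖‖x‖⁻¹ • x - ‖y‖⁻¹ • y‖) := by ring
        _ ≤ _ := by gcongr
    linarith
  · intro x hx
    have hn : DifferentiableAt ℝ (fun x : E => ‖x‖) x := (contDiffAt_norm ℝ hx).differentiableAt one_ne_zero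
    have hni : DifferentiableAt ℝ (fun x : E => ‖x‖⁻¹ • x) x :=
      (hn.inv (norm_pos_iff.2 hx).ne').smul differentiableAt_id
    have hud : DifferentiableAt ℝ u (‖x‖⁻¹ • x) := by
      have hwd := (hw.differentiable one_ne_zero) (‖x‖⁻¹ • x)
      have hwne := hw0 _ (hnn x hx)
      exact ((hwd.norm ℝ hwne).inv (norm_pos_iff.2 hwne).ne').smul hwd
    exact hn.smul (DifferentiableAt.comp (f := fun x : E => ‖x‖⁻¹ • x) x hud hni)
  · intro x
    by_cases hx : x = 0
    · simp [hx]
    have h1 := hworth _ (hnn x hx)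
    rw [inner_smul_right] at h1
    have h2 : inner ℝ (w (‖x‖⁻¹ • x)) x = 0 := by
      rcases mul_eq_zero.1 h1 with h | h
      · exact absurd h (inv_ne_zero (norm_pos_iff.2 hx).ne')
      · exact h
    simp only [V, u]
    rw [inner_smul_left, inner_smul_left, h2]
    simp

end PartA

section PartB
open Set

theorem cover_of_local {Y E : Type*} [TopologicalSpace Y] [NormedAddCommGroup E]
    [InnerProductSpace ℝ E] (w : Y → E) (hw0 : ∀ x, w x ≠ 0)
    (hloc : ∀ x0, ∃ W : Set Y, IsOpen W ∧ x0 ∈ W ∧ ∃ v : Y → E, ContinuousOn v W ∧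
      ∀ x ∈ W, w x = v x ∨ w x = - v x) :
    IsCoveringMap (fun q : {q : Y × E // q.2 = w q.1 ∨ q.2 = - w q.1} => q.1.1) := by
  have hcont : Continuous (fun q : {q : Y × E // q.2 = w q.1 ∨ q.2 = - w q.1} => q.1.1) := by
    fun_prop
  intro x0
  obtain ⟨W, hWo, hxW, v, hv, hvw⟩ := hloc x0
  refine IsEvenlyCovered.to_isEvenlyCovered_preimage (I := Bool) ?_
  have hv' : ∀ x ∈ W, v x ≠ 0 := by
    intro x hx h
    have := hvw x hx
    simp only [h, neg_zero, or_self] at this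
    exact hw0 x this
  have hq : ∀ q : {q : Y × E // q.2 = w q.1 ∨ q.2 = - w q.1}, q.1.1 ∈ W →
      q.1.2 = v q.1.1 ∨ q.1.2 = - v q.1.1 := by
    rintro ⟨⟨x, e⟩, h⟩ hx
    have h2 := hvw x hx
    simp only at h ⊢
    rcases h with h | h <;> rcases h2 with h2 | h2 <;> simp [h, h2]
  have hvr : Continuous (fun x : W => v x) := continuousOn_iff_continuous_domRestrict.1 hv
  refine ⟨inferInstance, W, hxW, hWo, hWo.preimage hcont, ?_⟩
  let π := (fun q : {q : Y × E // q.2 = w q.1 ∨ q.2 = - w q.1} => q.1.1)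
  have hin : Continuous fun q : π ⁻¹' W => (inner ℝ q.1.1.2 (v q.1.1.1) : ℝ) := by
    have h1 : Continuous fun q : π ⁻¹' W => v q.1.1.1 :=
      hvr.comp (show Continuous fun q : π ⁻¹' W => (⟨q.1.1.1, q.2⟩ : W) by fun_prop)
    have h2 : Continuous fun q : π ⁻¹' W => q.1.1.2 := by fun_prop
    exact h2.inner h1
  have hval : ∀ q : π ⁻¹' W, (inner ℝ q.1.1.2 (v q.1.1.1) : ℝ) ≠ 0 := by
    intro q
    have h0 := hv' _ q.2
    have : (inner ℝ (v q.1.1.1) (v q.1.1.1) : ℝ) ≠ 0 := by simpa using h0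
    rcases hq q.1 q.2 with h | h
    · rw [h]; exact this
    · rw [h, inner_neg_left]; exact neg_ne_zero.2 this
  refine ⟨{ toFun := fun q => (⟨q.1.1.1, q.2⟩, decide (0 < (inner ℝ q.1.1.2 (v q.1.1.1) : ℝ))),
            invFun := fun y => ⟨⟨(y.1.1, bif y.2 then v y.1.1 else - v y.1.1), ?_⟩, y.1.2⟩,
            left_inv := ?_, right_inv := ?_, continuous_toFun := ?_, continuous_invFun := ?_ }, ?_⟩
  · have := hvw y.1.1 y.1.2
    rcases y with ⟨⟨y, hy⟩, b⟩
    simp only at this ⊢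
    rcases this with h | h <;> cases b <;> simp [h]
  · intro q
    have hpos : (0 : ℝ) < inner ℝ (v q.1.1.1) (v q.1.1.1) := by
      exact real_inner_self_pos.2 (hv' _ q.2)
    apply Subtype.ext
    apply Subtype.ext
    refine Prod.ext rfl ?_
    simp only
    rcases hq q.1 q.2 with h | h
    · rw [h, decide_eq_true hpos]; rfl
    · rw [h, inner_neg_left, decide_eq_false (by linarith)]; rfl
  · rintro ⟨⟨x, hx⟩, b⟩
    refine Prod.ext rfl ?_
    have hpos : (0 : ℝ) < inner ℝ (v x) (v x) := real_inner_self_pos.2 (hv' _ hx)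
    cases b
    · simp only [cond_false, inner_neg_left]
      exact decide_eq_false (by linarith)
    · simp only [cond_true]
      exact decide_eq_true hpos
  · refine Continuous.prodMk (by fun_prop) ?_
    rw [continuous_discrete_rng]
    intro b
    cases b
    · have : (fun q : π ⁻¹' W => decide (0 < (inner ℝ q.1.1.2 (v q.1.1.1) : ℝ))) ⁻¹' {false} =
          {q : π ⁻¹' W | (inner ℝ q.1.1.2 (v q.1.1.1) : ℝ) < 0} := by
        ext q
        simp only [mem_preimage, mem_singleton_iff, decide_eq_false_iff_not, not_lt, mem_ofPred_eq]
        exact ⟨fun h => lt_of_le_of_ne h (hval q), le_of_lt⟩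
      rw [this]
      exact isOpen_lt hin continuous_const
    · have : (fun q : π ⁻¹' W => decide (0 < (inner ℝ q.1.1.2 (v q.1.1.1) : ℝ))) ⁻¹' {true} =
          {q : π ⁻¹' W | 0 < (inner ℝ q.1.1.2 (v q.1.1.1) : ℝ)} := by
        ext q
        simp
      rw [this]
      exact isOpen_lt continuous_const hin
  · refine Continuous.subtype_mk (Continuous.subtype_mk (Continuous.prodMk (by fun_prop) ?_) _) _
    rw [continuous_prod_of_discrete_right]
    intro b
    cases b
    · exact hvr.neg
    · exact hvr
  · intro q; rfl

theorem local_section {E T : Type*} [NormedAddCommGroup E] [InnerProductSpace ℝ E]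
    [FiniteDimensional ℝ E] [TopologicalSpace T] (f : T → Metric.sphere (0 : E) 1)
    (hf : IsCoveringMap f) (v : Metric.sphere (0 : E) 1) (e : T) (he : f e ≠ v) :
    ∃ σ : Metric.sphere (0 : E) 1 → T, ContinuousOn σ {v}ᶜ ∧ (∀ x, x ≠ v → f (σ x) = x) ∧
      σ (f e) = e := by
  let S := stereographic (norm_eq_of_mem_sphere v)
  have hsrc : S.source = {v}ᶜ := stereographic_source _
  have htgt : S.target = univ := stereographic_target _
  have hc : Continuous S.symm := by
    have := S.continuousOn_symm
    rwa [htgt, continuousOn_univ] at this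
  obtain ⟨F, ⟨hF1, hF2⟩, -⟩ := hf.existsUnique_continuousMap_lifts ⟨S.symm, hc⟩ (S (f e)) e
    (S.left_inv (by rw [hsrc]; exact he)).symm
  refine ⟨F ∘ S, ?_, ?_, hF1⟩
  · have := S.continuousOn
    rw [hsrc] at this
    exact F.continuous.comp_continuousOn this
  · intro x hx
    have := congrFun hF2 (S x)
    simp only [Function.comp] at this ⊢
    rw [this]
    exact S.left_inv (by rw [hsrc]; exact hx)

theorem global_section {E T : Type*} [NormedAddCommGroup E] [InnerProductSpace ℝ E]
    [FiniteDimensional ℝ E] [TopologicalSpace T] (m : ℕ) (hm : 2 ≤ m)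
    (hd : Module.finrank ℝ E = m + 1) (f : T → Metric.sphere (0 : E) 1)
    (hf : IsCoveringMap f) (hsurj : Function.Surjective f) :
    ∃ σ : Metric.sphere (0 : E) 1 → T, Continuous σ ∧ ∀ x, f (σ x) = x := by
  have : Fact (Module.finrank ℝ E = m + 1) := ⟨hd⟩
  have : Nontrivial E := Module.nontrivial_of_finrank_pos (R := ℝ) (by omega)
  have : Nonempty (Metric.sphere (0 : E) 1) := (NormedSpace.sphere_nonempty.2 zero_le_one).to_subtype
  obtain ⟨v⟩ := this
  let S := stereographic (norm_eq_of_mem_sphere v)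
  have hsrc : S.source = {v}ᶜ := stereographic_source _
  have htgt : S.target = univ := stereographic_target _
  have hc : Continuous S.symm := by
    have := S.continuousOn_symm
    rwa [htgt, continuousOn_univ] at this
  have hvne : -v ≠ v := by
    intro h
    have h1 : -(v : E) = v := congrArg Subtype.val h
    have h2 : (v : E) = 0 := by
      have h3 : (2 : ℝ) • (v : E) = 0 := by
        rw [two_smul]; nth_rewrite 1 [← h1]; exact neg_add_cancel _
      exact (smul_eq_zero.1 h3).resolve_left two_ne_zero
    exact ne_zero_of_mem_unit_sphere v h2
  have hSneg : S (-v) = 0 := stereographic_apply_neg v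
  have hconn : IsConnected ({v}ᶜ ∩ {-v}ᶜ : Set (Metric.sphere (0 : E) 1)) := by
    have h1 : IsConnected ({0}ᶜ : Set (Submodule.span ℝ {(v : E)})ᗮ) := by
      apply isConnected_compl_singleton_of_one_lt_rank
      rw [← Module.finrank_eq_rank, Submodule.finrank_orthogonal_span_singleton (n := m) (ne_zero_of_mem_unit_sphere v)]
      exact_mod_cast hm
    have h2 := h1.image S.symm hc.continuousOn
    convert h2 using 1
    ext x
    constructor
    · rintro ⟨hx1, hx2⟩
      refine ⟨S x, ?_, S.left_inv (by rw [hsrc]; exact hx1)⟩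
      intro h0
      apply hx2
      refine S.injOn (by rw [hsrc]; exact hx1) (by rw [hsrc]; exact hvne) ?_
      rw [hSneg]; exact h0
    · rintro ⟨y, hy, rfl⟩
      have hys : S.symm y ∈ S.source := S.map_target (by rw [htgt]; trivial)
      refine ⟨by rwa [hsrc] at hys, ?_⟩
      intro h
      apply hy
      have h3 : S (S.symm y) = y := S.right_inv (by rw [htgt]; trivial)
      rw [mem_singleton_iff] at h ⊢
      rw [← h3, h, hSneg]
  obtain ⟨y, hy1, hy2⟩ := hconn.nonempty
  obtain ⟨e, rfl⟩ := hsurj y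
  obtain ⟨σ1, c1, s1, e1⟩ := local_section f hf v e hy1
  obtain ⟨σ2, c2, s2, e2⟩ := local_section f hf (-v) e hy2
  have heq := hf.eqOn_of_comp_eqOn hconn.isPreconnected (c1.mono inter_subset_left)
    (c2.mono inter_subset_right) (fun x hx => by
      simp only [Function.comp]; rw [s1 x hx.1, s2 x hx.2]) ⟨hy1, hy2⟩ (e1.trans e2.symm)
  classical
  let σ : Metric.sphere (0 : E) 1 → T := fun x => if x = v then σ2 x else σ1 x
  have g1 : EqOn σ σ1 {v}ᶜ := fun x hx => if_neg hx
  have g2 : EqOn σ σ2 {-v}ᶜ := fun x hx => by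
    by_cases h : x = v
    · exact if_pos h
    · rw [g1 h]; exact heq ⟨h, hx⟩
  refine ⟨σ, ?_, ?_⟩
  · rw [continuous_iff_continuousAt]
    intro x
    by_cases h : x = v
    · have hx : x ∈ ({-v}ᶜ : Set _) := by
        rw [h]; exact fun h' => hvne h'.symm
      exact (c2.congr g2).continuousAt (isOpen_compl_singleton.mem_nhds hx)
    · exact (c1.congr g1).continuousAt (isOpen_compl_singleton.mem_nhds h)
  · intro x
    by_cases h : x = v
    · have hx : x ∈ ({-v}ᶜ : Set _) := by
        rw [h]; exact fun h' => hvne h'.symm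
      rw [g2 hx]; exact s2 x hx
    · rw [g1 h]; exact s1 x h

theorem lift_sign {E : Type*} [NormedAddCommGroup E] [InnerProductSpace ℝ E]
    [FiniteDimensional ℝ E] (m : ℕ) (hm : 2 ≤ m)
    (hd : Module.finrank ℝ E = m + 1) (w : Metric.sphere (0 : E) 1 → E) (hw0 : ∀ x, w x ≠ 0)
    (hloc : ∀ x0, ∃ W : Set (Metric.sphere (0 : E) 1), IsOpen W ∧ x0 ∈ W ∧
      ∃ v : Metric.sphere (0 : E) 1 → E, ContinuousOn v W ∧
      ∀ x ∈ W, w x = v x ∨ w x = - v x) :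
    ∃ g : Metric.sphere (0 : E) 1 → E, Continuous g ∧ ∀ x, g x = w x ∨ g x = - w x := by
  obtain ⟨σ, hσ, hs⟩ := global_section m hm hd _ (cover_of_local w hw0 hloc)
    (fun x => ⟨⟨(x, w x), Or.inl rfl⟩, rfl⟩)
  refine ⟨fun x => (σ x).1.2, by fun_prop, fun x => ?_⟩
  have := (σ x).2
  rwa [hs x] at this

end PartB

section PartC
open Set Filter Topology

/-- the unit circle in the plane is homeomorphic to `Circle` -/
theorem circle_homeo : Nonempty (Metric.sphere (0 : EuclideanSpace ℝ (Fin 2)) 1 ≃ₜ Circle) := by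
  let e := Complex.orthonormalBasisOneI.repr
  refine ⟨{ toFun := fun x => ⟨e.symm x, ?_⟩, invFun := fun z => ⟨e z, ?_⟩,
            left_inv := ?_, right_inv := ?_, continuous_toFun := ?_, continuous_invFun := ?_ }⟩
  · have : ‖e.symm x‖ = 1 := by rw [LinearIsometryEquiv.norm_map]; simp
    exact mem_sphere_zero_iff_norm.2 this
  · have : ‖e z‖ = 1 := by rw [LinearIsometryEquiv.norm_map]; exact Circle.norm_coe z
    exact mem_sphere_zero_iff_norm.2 this
  · intro x; apply Subtype.ext; exact e.apply_symm_apply _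
  · intro x; apply Subtype.ext; exact e.symm_apply_apply _
  · exact Continuous.subtype_mk (e.symm.continuous.comp continuous_subtype_val) _
  · exact Continuous.subtype_mk (e.continuous.comp continuous_subtype_val) _

/-- a chart of a circle bundle, seen on the total space -/
structure CChart {S X : Type*} [TopologicalSpace S] (p : S → X) (x0 : S) where
  V : Set S
  c : S → Circle
  R : S × ℝ → S
  openV : IsOpen V
  memV : x0 ∈ V
  sat : ∀ x y, p x = p y → x ∈ V → y ∈ V
  contc : ContinuousOn c V
  contR : ContinuousOn R (V ×ˢ univ)
  R_zero : ∀ x, R (x, 0) = x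
  pR : ∀ x s, p (R (x, s)) = p x
  cR : ∀ x ∈ V, ∀ s, c (R (x, s)) = c x * Circle.exp s
  inj : ∀ x ∈ V, ∀ y ∈ V, p x = p y → c x = c y → x = y

theorem exists_chart {S X : Type*} [TopologicalSpace S] [TopologicalSpace X] (p : S → X)
    (hp : Continuous p) (x0 : S) (U : Set X) (hU : IsOpen U) (hx : p x0 ∈ U)
    (φ : (p ⁻¹' U) ≃ₜ (U × Circle)) (hφ : ∀ e : p ⁻¹' U, ((φ e).1 : X) = p (e : _)) :
    Nonempty (CChart p x0) := by
  classical
  have hφs : ∀ y : U × Circle, p (φ.symm y).1 = y.1.1 := by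
    intro y
    rw [← hφ, φ.apply_symm_apply]
  let c : S → Circle := fun x => if h : x ∈ p ⁻¹' U then (φ ⟨x, h⟩).2 else 1
  let R : S × ℝ → S := fun q => if h : q.1 ∈ p ⁻¹' U then
    (φ.symm ((φ ⟨q.1, h⟩).1, (φ ⟨q.1, h⟩).2 * Circle.exp q.2)).1 else q.1
  have hc : ∀ x (h : x ∈ p ⁻¹' U), c x = (φ ⟨x, h⟩).2 := fun x h => dif_pos h
  have hR : ∀ x (h : x ∈ p ⁻¹' U) s, R (x, s) =
    (φ.symm ((φ ⟨x, h⟩).1, (φ ⟨x, h⟩).2 * Circle.exp s)).1 := fun x h s => dif_pos h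
  refine ⟨⟨p ⁻¹' U, c, R, hU.preimage hp, hx, ?_, ?_, ?_, ?_, ?_, ?_, ?_⟩⟩
  · intro x y hxy h
    simpa [← hxy] using h
  · rw [continuousOn_iff_continuous_domRestrict]
    have : (p ⁻¹' U).domRestrict c = fun x => (φ x).2 := by
      ext x; exact congrArg _ (hc x.1 x.2)
    rw [this]; fun_prop
  · rw [continuousOn_iff_continuous_domRestrict]
    have : ((p ⁻¹' U) ×ˢ (univ : Set ℝ)).domRestrict R = fun q =>
      (φ.symm ((φ ⟨q.1.1, q.2.1⟩).1, (φ ⟨q.1.1, q.2.1⟩).2 * Circle.exp q.1.2)).1 := by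
      ext q; exact hR q.1.1 q.2.1 q.1.2
    rw [this]
    have h1 : Continuous fun q : ((p ⁻¹' U) ×ˢ (univ : Set ℝ) : Set (S × ℝ)) =>
      φ ⟨q.1.1, q.2.1⟩ := φ.continuous.comp (by fun_prop)
    refine continuous_subtype_val.comp (φ.symm.continuous.comp ?_)
    exact (continuous_fst.comp h1).prodMk ((continuous_snd.comp h1).mul
      (Circle.exp.continuous.comp (by fun_prop)))
  · intro x
    by_cases h : x ∈ p ⁻¹' U
    · rw [hR x h]; simp
    · exact dif_neg h
  · intro x s
    by_cases h : x ∈ p ⁻¹' U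
    · rw [hR x h, hφs]; exact hφ _
    · exact congrArg p (dif_neg h)
  · intro x h s
    have h2 : R (x, s) ∈ p ⁻¹' U := by rw [hR x h]; exact Subtype.prop _
    rw [hc _ h2, hc x h]
    have : (⟨R (x, s), h2⟩ : p ⁻¹' U) = φ.symm ((φ ⟨x, h⟩).1, (φ ⟨x, h⟩).2 * Circle.exp s) :=
      Subtype.ext (hR x h s)
    rw [this, φ.apply_symm_apply]
  · intro x h y h' hxy hcc
    rw [hc x h, hc y h'] at hcc
    have : φ ⟨x, h⟩ = φ ⟨y, h'⟩ := by
      refine Prod.ext (Subtype.ext ?_) hcc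
      rw [hφ, hφ]; exact hxy
    exact congrArg Subtype.val (φ.injective this)

theorem order_chart {S X : Type*} [TopologicalSpace S] (p : S → X) (x0 : S)
    (C : CChart p x0) : ∃ N : Set S, IsOpen N ∧ x0 ∈ N ∧ ∃ θ : S → ℝ, ContinuousOn θ N ∧
      ∀ x ∈ N, ∀ y ∈ N, p x = p y → θ x = θ y → x = y := by
  have hcont : ContinuousOn (fun y => ((C.c y / C.c x0 : Circle) : ℂ)) C.V :=
    continuous_subtype_val.comp_continuousOn
      (show ContinuousOn (fun y => C.c y / C.c x0) C.V from C.contc.div_const (C.c x0))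
  refine ⟨C.V ∩ (fun y => ((C.c y / C.c x0 : Circle) : ℂ)) ⁻¹' Complex.slitPlane,
    hcont.isOpen_inter_preimage C.openV Complex.isOpen_slitPlane, ⟨C.memV, by simp⟩,
    fun y => Complex.arg ((C.c y / C.c x0 : Circle) : ℂ), ?_, ?_⟩
  · intro y hy
    exact ContinuousAt.comp_continuousWithinAt (g := Complex.arg)
      (f := fun y => ((C.c y / C.c x0 : Circle) : ℂ)) (Complex.continuousAt_arg hy.2)
      ((hcont y hy.1).mono inter_subset_left)
  · intro x hx y hy hxy h
    have h1 : (C.c x / C.c x0) = (C.c y / C.c x0) := Circle.injective_arg h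
    exact C.inj x hx.1 y hy.1 hxy (div_left_injective h1)

theorem small_move {S X : Type*} [MetricSpace S] (p : S → X) (x0 : S)
    (C : CChart p x0) (ε : ℝ) (hε : 0 < ε) : ∃ r > 0, ∃ η > 0, η < Real.pi ∧
      Metric.ball x0 r ⊆ C.V ∧
      ∀ x ∈ Metric.ball x0 r, ∀ s, |s| ≤ η → dist (C.R (x, s)) x < ε := by
  have h1 : ContinuousAt C.R (x0, 0) :=
    C.contR.continuousAt ((C.openV.prod isOpen_univ).mem_nhds ⟨C.memV, trivial⟩)
  have h2 : ContinuousAt (fun q : S × ℝ => dist (C.R q) q.1) (x0, 0) :=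
    h1.dist continuousAt_fst
  have h3 : ∀ᶠ q in 𝓝 (x0, (0 : ℝ)), dist (C.R q) q.1 < ε := by
    apply h2.eventually_lt continuousAt_const
    simpa [C.R_zero] using hε
  rw [nhds_prod_eq] at h3
  obtain ⟨P, hP, Q, hQ, hPQ⟩ := eventually_prod_iff.1 h3
  obtain ⟨r, hr, hrP⟩ := Metric.eventually_nhds_iff_ball.1 (hP.and (C.openV.mem_nhds C.memV))
  obtain ⟨η, hη, hηQ⟩ := Metric.eventually_nhds_iff_ball.1 hQ
  refine ⟨r, hr, min (η / 2) 1, by positivity, ?_, fun x hx => (hrP x hx).2, ?_⟩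
  · exact (min_le_right _ _).trans_lt (by linarith [Real.pi_gt_three])
  · intro x hx s hs
    refine hPQ (hrP x hx).1 (hηQ s ?_)
    rw [mem_ball_zero_iff, Real.norm_eq_abs]
    linarith [min_le_left (η / 2) 1]

theorem exp_inj {s t : ℝ} (hs : |s| < Real.pi) (ht : |t| < Real.pi)
    (h : Circle.exp s = Circle.exp t) : s = t := by
  rw [abs_lt] at hs ht
  exact Circle.exp_injOn_Ioc (a := -Real.pi) (b := Real.pi) (by linarith)
    ⟨hs.1, hs.2.le⟩ ⟨ht.1, ht.2.le⟩ h

theorem local_arc {S X : Type*} [MetricSpace S] (p : S → X) (x0 : S)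
    (C : CChart p x0) (ε : ℝ) (hε : 0 < ε) : ∃ δ > 0, ∀ x ∈ Metric.ball x0 δ,
      ∃ η > 0, ∃ γ : ℝ → S, ContinuousOn γ (Icc (-η) η) ∧ InjOn γ (Icc (-η) η) ∧
        (∀ s ∈ Icc (-η) η, p (γ s) = p x ∧ dist (γ s) x < ε) ∧
        ∀ y, p y = p x → dist y x < δ → ∃ s ∈ Icc (-η) η, γ s = y := by
  obtain ⟨r, hr, η, hη, hηπ, hrV, hmove⟩ := small_move p x0 C ε hε
  have hcx : ContinuousAt C.c x0 := C.contc.continuousAt (C.openV.mem_nhds C.memV)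
  have h1 : ContinuousAt (fun q : S × S => C.c q.2 / C.c q.1) (x0, x0) :=
    ContinuousAt.div' (ContinuousAt.comp (f := Prod.snd) (x := (x0, x0)) hcx continuousAt_snd)
      (ContinuousAt.comp (f := Prod.fst) (x := (x0, x0)) hcx continuousAt_fst)
  have h2 : ContinuousAt (fun q : S × S => |Complex.arg ((C.c q.2 / C.c q.1 : Circle) : ℂ)|)
      (x0, x0) := by
    apply ContinuousAt.abs
    apply ContinuousAt.comp (g := Complex.arg)
    · apply Complex.continuousAt_arg; simp
    · exact continuous_subtype_val.continuousAt.comp h1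
  have h3 : ∀ᶠ q in 𝓝 (x0, x0), |Complex.arg ((C.c q.2 / C.c q.1 : Circle) : ℂ)| < η := by
    apply h2.eventually_lt continuousAt_const
    simpa using hη
  obtain ⟨r', hr', hball⟩ := Metric.eventually_nhds_iff_ball.1 h3
  refine ⟨min r r' / 2, by positivity, ?_⟩
  intro x hx
  rw [Metric.mem_ball] at hx
  have hxr : x ∈ Metric.ball x0 r := by
    rw [Metric.mem_ball]; linarith [min_le_left r r']
  have hxV := hrV hxr
  refine ⟨η, hη, fun s => C.R (x, s), ?_, ?_, ?_, ?_⟩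
  · exact C.contR.comp (by fun_prop) (fun s _ => ⟨hxV, trivial⟩)
  · intro s hs t ht hst
    have h4 := congrArg C.c hst
    simp only [C.cR x hxV] at h4
    refine exp_inj ((abs_le.2 hs).trans_lt hηπ) ((abs_le.2 ht).trans_lt hηπ) (mul_left_cancel h4)
  · intro s hs
    exact ⟨C.pR x s, hmove x hxr s (abs_le.2 hs)⟩
  · intro y hy hyx
    have hyV : y ∈ C.V := C.sat x y hy.symm hxV
    have hyx0 : dist y x0 < min r r' := by linarith [dist_triangle y x x0]
    refine ⟨Complex.arg ((C.c y / C.c x : Circle) : ℂ), ?_, ?_⟩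
    · refine abs_le.1 (hball (x, y) ?_).le
      rw [Metric.mem_ball, Prod.dist_eq]
      refine max_lt ?_ ?_
      · have := min_le_right r r'
        simp only; linarith
      · exact hyx0.trans_le (min_le_right _ _)
    · have hRV : C.R (x, Complex.arg ((C.c y / C.c x : Circle) : ℂ)) ∈ C.V :=
        C.sat x _ (C.pR x _).symm hxV
      refine C.inj _ hRV y hyV ((C.pR x _).trans hy.symm) ?_
      rw [C.cR x hxV, Circle.exp_arg]
      exact mul_div_cancel _ _

theorem local_bump {S X : Type*} [MetricSpace S] (p : S → X) (x0 : S)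
    (C : CChart p x0) (δ : ℝ) (hδ : 0 < δ) : ∃ z : S → S, Continuous z ∧ (∀ x, p (z x) = p x) ∧
      (∀ x, dist (z x) x < δ) ∧ ∀ᶠ x in 𝓝 x0, z x ≠ x := by
  obtain ⟨r, hr, η, hη, hηπ, hrV, hmove⟩ := small_move p x0 C δ hδ
  let ρ : S → ℝ := fun x => η * max 0 (1 - dist x x0 / (r / 2))
  have hρc : Continuous ρ := by fun_prop
  have hρ0 : ∀ x, 0 ≤ ρ x := fun x => by positivity
  have hρ1 : ∀ x, ρ x ≤ η := fun x => by
    have : max 0 (1 - dist x x0 / (r / 2)) ≤ 1 :=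
      max_le zero_le_one (by have : 0 ≤ dist x x0 / (r / 2) := by positivity
                             linarith)
    simp only [ρ]; nlinarith
  have hρz : ∀ x, r / 2 ≤ dist x x0 → ρ x = 0 := fun x hx => by
    have : 1 ≤ dist x x0 / (r / 2) := (one_le_div (by positivity)).2 hx
    simp only [ρ]
    rw [max_eq_left (by linarith), mul_zero]
  have hρp : ∀ x, dist x x0 < r / 2 → 0 < ρ x := fun x hx => by
    have : dist x x0 / (r / 2) < 1 := (div_lt_one (by positivity)).2 hx
    simp only [ρ]
    rw [max_eq_right (by linarith)]
    apply mul_pos hη; linarith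
  have hid : ∀ x, r / 2 ≤ dist x x0 → C.R (x, ρ x) = x := fun x hx => by
    rw [hρz x hx, C.R_zero]
  refine ⟨fun x => C.R (x, ρ x), ?_, fun x => C.pR x _, ?_, ?_⟩
  · rw [continuous_iff_continuousAt]
    intro x
    by_cases hx : dist x x0 < r
    · have hxV := hrV hx
      have h1 : ContinuousAt C.R (x, ρ x) :=
        C.contR.continuousAt ((C.openV.prod isOpen_univ).mem_nhds ⟨hxV, trivial⟩)
      exact ContinuousAt.comp (f := fun x => (x, ρ x)) h1 (by fun_prop)
    · have : (fun x => C.R (x, ρ x)) =ᶠ[𝓝 x] id := by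
        have hlt : ∀ᶠ y in 𝓝 x, r / 2 < dist y x0 := by
          apply (continuousAt_const (y := r / 2)).eventually_lt (by fun_prop)
          linarith
        filter_upwards [hlt] with y hy
        exact hid y hy.le
      exact continuousAt_id.congr this.symm
  · intro x
    by_cases hx : dist x x0 < r
    · exact hmove x hx _ (by rw [abs_of_nonneg (hρ0 x)]; exact hρ1 x)
    · simp only
      rw [hid x (by linarith), dist_self]; exact hδ
  · filter_upwards [Metric.ball_mem_nhds x0 (show 0 < r / 2 by positivity)] with x hx h
    rw [Metric.mem_ball] at hx
    have hxV : x ∈ C.V := hrV (Metric.mem_ball.2 (by linarith))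
    have h1 := C.cR x hxV (ρ x)
    rw [h] at h1
    have h2 : Circle.exp (ρ x) = Circle.exp 0 := by simpa using h1
    have h3 := exp_inj (by rw [abs_of_nonneg (hρ0 x)]; linarith [hρ1 x]) (by simpa using Real.pi_pos) h2
    linarith [hρp x hx]

/-- continuous selection of the maximiser of `θ` among finitely many points -/
theorem argmax_cont {S : Type*} [MetricSpace S] {ι : Type*} [Finite ι] [Nonempty ι]
    (z : ι → S → S) (hz : ∀ i, Continuous (z i)) (W N : Set S) (hN : IsOpen N)
    (hzN : ∀ i, ∀ x ∈ W, z i x ∈ N)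
    (θ : S → ℝ) (hθ : ContinuousOn θ N)
    (hinj : ∀ x ∈ W, ∀ i j, θ (z i x) = θ (z j x) → z i x = z j x) :
    ∃ a : S → S, ContinuousOn a W ∧
      ∀ x, ∃ i, a x = z i x ∧ ∀ j, θ (z j x) ≤ θ (z i x) := by
  have hex : ∀ x, ∃ i, ∀ j, θ (z j x) ≤ θ (z i x) := fun x =>
    Finite.exists_max (fun i => θ (z i x))
  choose m hm using hex
  refine ⟨fun x => z (m x) x, ?_, fun x => ⟨m x, rfl, hm x⟩⟩
  intro x1 hx1
  have hθz : ∀ i, ContinuousAt (fun x => θ (z i x)) x1 := fun i =>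
    ContinuousAt.comp (g := θ) (f := z i)
      (hθ.continuousAt (hN.mem_nhds (hzN i x1 hx1))) (hz i).continuousAt
  rw [ContinuousWithinAt, tendsto_def]
  intro O hO
  have key : ∀ j, ∀ᶠ x in 𝓝 x1, z j x ∈ O ∨ θ (z j x) < θ (z (m x1) x) := by
    intro j
    rcases (hm x1 j).eq_or_lt with h | h
    · have h2 : z j x1 = z (m x1) x1 := hinj x1 hx1 _ _ h
      have h3 : ∀ᶠ x in 𝓝 x1, z j x ∈ O :=
        (hz j).continuousAt (x := x1) (by rw [h2]; exact hO)
      exact h3.mono fun x h => Or.inl h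
    · exact ((hθz j).eventually_lt (hθz (m x1)) h).mono fun x h => Or.inr h
  have key2 := eventually_all.2 key
  apply mem_nhdsWithin_of_mem_nhds
  filter_upwards [key2] with x hx
  rcases hx (m x) with h | h
  · exact h
  · exact absurd (hm x (m x1)) (not_le.2 h)

theorem uniform_order {S X : Type*} [MetricSpace S] [CompactSpace S] (p : S → X)
    (hC : ∀ x0, Nonempty (CChart p x0)) : ∃ ε > 0, ∀ x0, ∃ θ : S → ℝ,
      ContinuousOn θ (Metric.ball x0 ε) ∧
      ∀ x ∈ Metric.ball x0 ε, ∀ y ∈ Metric.ball x0 ε, p x = p y → θ x = θ y → x = y := by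
  choose N hN hxN θ hθ hinj using fun x0 => order_chart p x0 (hC x0).some
  obtain ⟨ε, hε, h⟩ := lebesgue_number_lemma_of_metric (isCompact_univ (X := S)) hN
    (fun x _ => mem_iUnion.2 ⟨x, hxN x⟩)
  refine ⟨ε, hε, fun x0 => ?_⟩
  obtain ⟨i, hi⟩ := h x0 trivial
  exact ⟨θ i, (hθ i).mono hi, fun x hx y hy => hinj i x (hi hx) y (hi hy)⟩

theorem uniform_arc {S X : Type*} [MetricSpace S] [CompactSpace S] (p : S → X)
    (hC : ∀ x0, Nonempty (CChart p x0)) (ε : ℝ) (hε : 0 < ε) : ∃ δ > 0, ∀ x,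
      ∃ η > 0, ∃ γ : ℝ → S, ContinuousOn γ (Icc (-η) η) ∧ InjOn γ (Icc (-η) η) ∧
        (∀ s ∈ Icc (-η) η, p (γ s) = p x ∧ dist (γ s) x < ε) ∧
        ∀ y, p y = p x → dist y x < δ → ∃ s ∈ Icc (-η) η, γ s = y := by
  classical
  choose δ hδ h using fun x0 => local_arc p x0 (hC x0).some ε hε
  obtain ⟨t, ht⟩ := isCompact_univ.elim_finite_subcover (fun x0 => Metric.ball x0 (δ x0))
    (fun _ => Metric.isOpen_ball) (fun x _ => mem_iUnion.2 ⟨x, Metric.mem_ball_self (hδ x)⟩)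
  have hmin : ∃ d > 0, ∀ i ∈ t, d ≤ δ i := by
    clear ht
    induction t using Finset.induction_on with
    | empty => exact ⟨1, one_pos, by simp⟩
    | insert a s _ ih =>
      obtain ⟨d, hd, hd2⟩ := ih
      refine ⟨min d (δ a), lt_min hd (hδ a), ?_⟩
      intro i hi
      rcases Finset.mem_insert.1 hi with rfl | hi
      · exact min_le_right _ _
      · exact (min_le_left _ _).trans (hd2 i hi)
  obtain ⟨d, hd, hd2⟩ := hmin
  refine ⟨d, hd, fun x => ?_⟩
  obtain ⟨i, hi, hxi⟩ := mem_iUnion₂.1 (ht (mem_univ x))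
  obtain ⟨η, hη, γ, h1, h2, h3, h4⟩ := h i x hxi
  exact ⟨η, hη, γ, h1, h2, h3, fun y hy hyx => h4 y hy (hyx.trans_le (hd2 i hi))⟩

theorem finite_family {S X : Type*} [MetricSpace S] [CompactSpace S] (p : S → X)
    (hC : ∀ x0, Nonempty (CChart p x0)) (δ : ℝ) (hδ : 0 < δ) :
    ∃ (t : Finset S) (z : Option t → S → S), (∀ i, Continuous (z i)) ∧
      (∀ i x, p (z i x) = p x) ∧ (∀ i x, dist (z i x) x < δ) ∧
      (∀ x, z none x = x) ∧ ∀ x, ∃ i, z i x ≠ x := by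
  choose z hz hp hd hne using fun x0 => local_bump p x0 (hC x0).some δ hδ
  have hne2 : ∀ x0, ∃ V, IsOpen V ∧ x0 ∈ V ∧ ∀ x ∈ V, z x0 x ≠ x := by
    intro x0
    obtain ⟨V, h1, h2, h3⟩ := mem_nhds_iff.1 (hne x0)
    exact ⟨V, h2, h3, fun x hx => h1 hx⟩
  choose V hV hxV hVne using hne2
  obtain ⟨t, ht⟩ := isCompact_univ.elim_finite_subcover V hV
    (fun x _ => mem_iUnion.2 ⟨x, hxV x⟩)
  refine ⟨t, fun i => Option.elim i id (fun j => z j.1), ?_, ?_, ?_, ?_, ?_⟩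
  · rintro (_ | i)
    · exact continuous_id
    · exact hz _
  · rintro (_ | i) x
    · rfl
    · exact hp _ _
  · rintro (_ | i) x
    · simpa using hδ
    · exact hd _ _
  · intro x; rfl
  · intro x
    obtain ⟨i, hi, hxi⟩ := mem_iUnion₂.1 (ht (mem_univ x))
    exact ⟨some ⟨i, hi⟩, hVne i x hxi⟩

/-- Along the fibres one can choose locally continuously (up to swapping) two distinct nearby
points. -/
theorem pair_selection {S X : Type*} [MetricSpace S] [CompactSpace S] (p : S → X)
    (hC : ∀ x0, Nonempty (CChart p x0)) (r : ℝ) (hr : 0 < r) :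
    ∃ A B : S → S, (∀ x, A x ≠ B x) ∧ (∀ x, dist (A x) x < r) ∧ (∀ x, dist (B x) x < r) ∧
      ∀ x0, ∃ W, IsOpen W ∧ x0 ∈ W ∧ ∃ a b : S → S, ContinuousOn a W ∧ ContinuousOn b W ∧
        ∀ x ∈ W, (A x = a x ∧ B x = b x) ∨ (A x = b x ∧ B x = a x) := by
  obtain ⟨ε, hε, hord⟩ := uniform_order p hC
  obtain ⟨δ, hδ, harc⟩ := uniform_arc p hC (ε / 2) (by positivity)
  obtain ⟨ι, z, hz, hpz, hdz, hz0, hzne⟩ :=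
    finite_family p hC (min δ (min r (ε / 2))) (by positivity)
  have hdδ : ∀ i x, dist (z i x) x < δ := fun i x => (hdz i x).trans_le (min_le_left _ _)
  have hdr : ∀ i x, dist (z i x) x < r := fun i x =>
    (hdz i x).trans_le ((min_le_right _ _).trans (min_le_left _ _))
  have hdε : ∀ i x, dist (z i x) x < ε / 2 := fun i x =>
    (hdz i x).trans_le ((min_le_right _ _).trans (min_le_right _ _))
  choose η hη γ hγc hγi hγ hγs using harc
  choose τ hτ hτz using fun x i => hγs x (z i x) (hpz i x) (hdδ i x)
  choose M hM using fun x => Finite.exists_max (τ x)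
  choose m hm using fun x => Finite.exists_min (τ x)
  refine ⟨fun x => z (M x) x, fun x => z (m x) x, ?_, fun x => hdr _ _, fun x => hdr _ _, ?_⟩
  · intro x h
    have h1 : τ x (M x) = τ x (m x) := by
      apply hγi x (hτ _ _) (hτ _ _)
      rw [hτz, hτz]; exact h
    obtain ⟨i, hi⟩ := hzne x
    have h2 : ∀ j, τ x j = τ x (M x) := fun j =>
      le_antisymm (hM x j) (h1.trans_le (hm x j))
    apply hi
    rw [← hτz x i, h2 i, ← h2 none, hτz, hz0]
  · intro x0
    obtain ⟨θ, hθ, hinj⟩ := hord x0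
    have hsub : ∀ x ∈ Metric.ball x0 (ε / 2), ∀ y, dist y x < ε / 2 → y ∈ Metric.ball x0 ε := by
      intro x hx y hy
      rw [Metric.mem_ball] at *
      linarith [dist_triangle y x x0]
    have hzN : ∀ i, ∀ x ∈ Metric.ball x0 (ε / 2), z i x ∈ Metric.ball x0 ε :=
      fun i x hx => hsub x hx _ (hdε i x)
    have hzinj : ∀ x ∈ Metric.ball x0 (ε / 2), ∀ i j, θ (z i x) = θ (z j x) → z i x = z j x :=
      fun x hx i j h => hinj _ (hzN i x hx) _ (hzN j x hx) ((hpz i x).trans (hpz j x).symm) h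
    obtain ⟨a, ha, ha2⟩ := argmax_cont z hz (Metric.ball x0 (ε / 2)) (Metric.ball x0 ε)
      Metric.isOpen_ball hzN θ hθ hzinj
    obtain ⟨b, hb, hb2⟩ := argmax_cont z hz (Metric.ball x0 (ε / 2)) (Metric.ball x0 ε)
      Metric.isOpen_ball hzN (fun y => - θ y) hθ.neg
      (fun x hx i j h => hzinj x hx i j (neg_injective h))
    refine ⟨Metric.ball x0 (ε / 2), Metric.isOpen_ball, Metric.mem_ball_self (by positivity),
      a, b, ha, hb, ?_⟩
    intro x hx
    obtain ⟨i, hi, hi2⟩ := ha2 x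
    obtain ⟨k, hk, hk2⟩ := hb2 x
    have hmaps : MapsTo (γ x) (Icc (-η x) (η x)) (Metric.ball x0 ε) :=
      fun s hs => hsub x hx _ (hγ x s hs).2
    have hc : ContinuousOn (θ ∘ γ x) (Icc (-η x) (η x)) := hθ.comp (hγc x) hmaps
    have hI : InjOn (θ ∘ γ x) (Icc (-η x) (η x)) := by
      intro s hs t ht h
      exact hγi x hs ht (hinj _ (hmaps hs) _ (hmaps ht)
        ((hγ x s hs).1.trans (hγ x t ht).1.symm) h)
    have hval : ∀ j, (θ ∘ γ x) (τ x j) = θ (z j x) := fun j => by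
      simp only [Function.comp, hτz]
    rcases ContinuousOn.strictMonoOn_of_injOn_Icc' (by linarith [hη x]) hc hI with hmono | hanti
    · left
      constructor
      · rw [hi]
        apply hzinj x hx
        apply le_antisymm (hi2 _)
        rw [← hval, ← hval]
        exact hmono.monotoneOn (hτ _ _) (hτ _ _) (hM x i)
      · rw [hk]
        apply hzinj x hx
        apply le_antisymm _ (neg_le_neg_iff.1 (hk2 _))
        rw [← hval, ← hval]
        exact hmono.monotoneOn (hτ _ _) (hτ _ _) (hm x k)
    · right
      constructor
      · rw [hk]
        apply hzinj x hx
        apply le_antisymm _ (neg_le_neg_iff.1 (hk2 _))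
        rw [← hval, ← hval]
        exact hanti.antitoneOn (hτ _ _) (hτ _ _) (hM x k)
      · rw [hi]
        apply hzinj x hx
        apply le_antisymm (hi2 _)
        rw [← hval, ← hval]
        exact hanti.antitoneOn (hτ _ _) (hτ _ _) (hm x i)

theorem inner_pos_of_close {E : Type*} [NormedAddCommGroup E] [InnerProductSpace ℝ E]
    (a x : E) (ha : ‖a‖ = 1) (hx : ‖x‖ = 1) (h : dist a x < 1) : 0 < inner ℝ a x := by
  have h1 := norm_sub_sq_real a x
  rw [dist_eq_norm] at h
  rw [ha, hx] at h1
  nlinarith [norm_nonneg (a - x)]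

theorem tangent_ne_zero {E : Type*} [NormedAddCommGroup E] [InnerProductSpace ℝ E]
    (a b x : E) (ha : ‖a‖ = 1) (hb : ‖b‖ = 1) (hx : ‖x‖ = 1) (hax : dist a x < 1)
    (hbx : dist b x < 1) (hab : a ≠ b) : a - b - (inner ℝ (a - b) x : ℝ) • x ≠ 0 := by
  intro h
  have pa := inner_pos_of_close a x ha hx hax
  have pb := inner_pos_of_close b x hb hx hbx
  set l : ℝ := inner ℝ (a - b) x with hl
  have h1 : a = b + l • x := by
    rw [sub_eq_zero] at h; rw [← h]; abel
  have h2 : (1 : ℝ) = 1 + 2 * (l * inner ℝ b x) + l ^ 2 := by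
    have := norm_add_sq_real b (l • x)
    rw [← h1, ha, hb, norm_smul, hx, inner_smul_right] at this
    simpa using this
  have h3 : (inner ℝ a x : ℝ) = inner ℝ b x + l := by
    rw [hl, inner_sub_left]; ring
  have h4 : l * (inner ℝ a x + inner ℝ b x) = 0 := by rw [h3]; linarith
  rcases mul_eq_zero.1 h4 with h5 | h5
  · apply hab; rw [h1, h5]; simp
  · linarith

end PartC

/-- No even-dimensional sphere `S^{2n}` (`n ≥ 1`) admits a fibration with
circle fibers: there is no continuous map `p : S^{2n} → X` which is a locally
trivial fiber bundle with fiber the circle `S¹`. -/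
theorem no_circle_fibration_of_even_sphere (n : ℕ) (hn : 1 ≤ n) :
    ¬ ∃ (X : Type) (_ : TopologicalSpace X)
        (p : Metric.sphere (0 : EuclideanSpace ℝ (Fin (2 * n + 1))) 1 → X),
        Continuous p ∧
        ∀ x : X, ∃ U : Set X, IsOpen U ∧ x ∈ U ∧
          ∃ φ : (p ⁻¹' U) ≃ₜ
              (U × Metric.sphere (0 : EuclideanSpace ℝ (Fin 2)) 1),
            ∀ e : p ⁻¹' U, ((φ e).1 : X) = p (e : _) := by
  rintro ⟨X, _, p, hp, hloc⟩
  obtain ⟨k⟩ := circle_homeo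
  have hC : ∀ x0, Nonempty (CChart p x0) := by
    intro x0
    obtain ⟨U, hU, hx, φ, hφ⟩ := hloc (p x0)
    exact exists_chart p hp x0 U hU hx (φ.trans ((Homeomorph.refl U).prodCongr k)) hφ
  obtain ⟨A, B, hAB, hA, hB, hsel⟩ := pair_selection p hC 1 one_pos
  have hd : Module.finrank ℝ (EuclideanSpace ℝ (Fin (2 * n + 1))) = 2 * n + 1 :=
    finrank_euclideanSpace_fin
  obtain ⟨g, hg, hgw⟩ := lift_sign (2 * n) (by omega) hd
    (fun x => (A x : EuclideanSpace ℝ (Fin (2 * n + 1))) - B x)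
    (fun x h => hAB x (Subtype.ext (sub_eq_zero.1 h))) (by
      intro x0
      obtain ⟨W, hW, hx, a, b, ha, hb, h⟩ := hsel x0
      refine ⟨W, hW, hx, fun x => (a x : EuclideanSpace ℝ (Fin (2 * n + 1))) - b x,
        (continuous_subtype_val.comp_continuousOn ha).sub
          (continuous_subtype_val.comp_continuousOn hb), ?_⟩
      intro x hxW
      rcases h x hxW with ⟨h1, h2⟩ | ⟨h1, h2⟩
      · left; simp only [h1, h2]
      · right; simp only [h1, h2, neg_sub])
  have hnorm : ∀ x : Metric.sphere (0 : EuclideanSpace ℝ (Fin (2 * n + 1))) 1,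
      ‖(x : EuclideanSpace ℝ (Fin (2 * n + 1)))‖ = 1 := fun x => mem_sphere_zero_iff_norm.1 x.2
  refine hairy_ball n hd (fun x => g x - (inner ℝ (g x) (x : EuclideanSpace ℝ _) : ℝ) •
    (x : EuclideanSpace ℝ (Fin (2 * n + 1)))) ?_ ?_ ?_
  · have hi : Continuous fun x : Metric.sphere (0 : EuclideanSpace ℝ (Fin (2 * n + 1))) 1 =>
        (inner ℝ (g x) (x : EuclideanSpace ℝ (Fin (2 * n + 1))) : ℝ) :=
      hg.inner continuous_subtype_val
    fun_prop
  · intro x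
    rcases hgw x with h | h
    · simp only [h]
      exact tangent_ne_zero _ _ _ (hnorm _) (hnorm _) (hnorm _) (hA x) (hB x)
        (fun e => hAB x (Subtype.ext e))
    · simp only [h, neg_sub]
      exact tangent_ne_zero _ _ _ (hnorm _) (hnorm _) (hnorm _) (hB x) (hA x)
        (fun e => hAB x (Subtype.ext e.symm))
  · intro x
    simp only [inner_sub_left, inner_smul_left, real_inner_self_eq_norm_sq, hnorm x]
    simp
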